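/- Let E be a real Banach space, P ⊆ E a closed cone, and b : E × E → E a bounded bilinear map with b(P × P) ⊆ P which is compact on P (it maps bounded subsets of P × P to relatively compact sets), and let B = sup{‖b(u,v)‖ : u, v ∈ P, ‖u‖ = ‖v‖ = 1} be its norm on the cone. Assume the coercivity condition inf{‖b(u,u)‖ : u ∈ P, ‖u‖ = 1} > 0. Then for every u₀ ∈ P with u₀ ≠ 0 satisfying 4·B·‖u₀‖ < 1, the equation u = b(u,u) + u₀ admits at least two distinct solutions u ∈ P. -/

import Mathlib

open Set Bornology

section ConeFixedPoint

open MeasureTheory Metric Polynomial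

theorem LinearMap.exists_polynomial_eval_det_one_add_smul {E : Type*} [AddCommGroup E]
    [Module ℝ E] [Module.Finite ℝ E] (A : E →ₗ[ℝ] E) :
    ∃ p : ℝ[X], p.natDegree ≤ Module.finrank ℝ E ∧
      ∀ t : ℝ, p.eval t = LinearMap.det (1 + t • A) := by
  classical
  let e := Module.finBasis ℝ E
  let M := LinearMap.toMatrix e e A
  refine ⟨((X : ℝ[X]) • M.map C + (1 : Matrix _ _ ℝ).map C).det, ?_, fun t => ?_⟩
  · simpa using Polynomial.natDegree_det_X_add_C_le M 1
  · rw [← LinearMap.det_toMatrix e, ← Polynomial.coe_evalRingHom, RingHom.map_det]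
    congr 1
    ext i j
    rcases eq_or_ne i j with rfl | hij
    · simp [M, add_comm, mul_comm t]
    · simp [M, hij, mul_comm t]

theorem exists_lagrange_quadrature (n : ℕ) {δ : ℝ} (hδ : 0 < δ) :
    ∃ w t : ℕ → ℝ, (∀ i, 0 < t i ∧ t i < δ) ∧ ∀ p : ℝ[X], p.natDegree ≤ n →
      p.eval 1 = ∑ i ∈ Finset.range (n + 1), w i * p.eval (t i) := by
  let t : ℕ → ℝ := fun i => δ / (i + 2)
  have ht : InjOn t (Finset.range (n + 1) : Set ℕ) := by
    intro i _ j _ h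
    have hi : (0 : ℝ) < i + 2 := by positivity
    have hj : (0 : ℝ) < j + 2 := by positivity
    have h' : δ / (i + 2) = δ / (j + 2) := h
    rw [div_eq_div_iff hi.ne' hj.ne'] at h'
    have := mul_left_cancel₀ hδ.ne' h'
    exact_mod_cast (by linarith : (i : ℝ) = j)
  refine ⟨fun i => (Lagrange.basis (Finset.range (n + 1)) t i).eval 1, t, fun i => ?_,
    fun p hp => ?_⟩
  · have hi : (0 : ℝ) < i + 2 := by positivity
    refine ⟨by positivity, ?_⟩
    rw [div_lt_iff₀ hi]
    nlinarith [(Nat.cast_nonneg i : (0 : ℝ) ≤ i)]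
  · have hdeg : p.degree < (Finset.range (n + 1)).card := by
      rw [Finset.card_range]
      exact (Polynomial.degree_le_natDegree).trans_lt (by exact_mod_cast Nat.lt_succ_of_le hp)
    conv_lhs => rw [Lagrange.eq_interpolate ht hdeg, Lagrange.interpolate_apply]
    simp [Polynomial.eval_finsetSum, mul_comm]

theorem ContinuousLinearMap.det_one_add_pos {E : Type*} [NormedAddCommGroup E]
    [NormedSpace ℝ E] [FiniteDimensional ℝ E] {A : E →L[ℝ] E} (hA : ‖A‖ < 1) :
    0 < LinearMap.det (1 + (A : E →ₗ[ℝ] E)) := by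
  obtain ⟨p, -, hp⟩ := LinearMap.exists_polynomial_eval_det_one_add_smul (A : E →ₗ[ℝ] E)
  have hne : ∀ s ∈ Icc (0 : ℝ) 1, p.eval s ≠ 0 := by
    intro s hs h
    rw [hp] at h
    obtain ⟨v, hv, hv0⟩ := Submodule.exists_mem_ne_zero_of_ne_bot
      (LinearMap.bot_lt_ker_of_det_eq_zero h).ne'
    have hv' : v = -(s • A v) := eq_neg_of_add_eq_zero_left (by simpa using hv)
    have hpos : 0 < ‖v‖ := norm_pos_iff.mpr hv0
    have hle : ‖v‖ ≤ s * (‖A‖ * ‖v‖) := by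
      conv_lhs => rw [hv', norm_neg, norm_smul, Real.norm_of_nonneg hs.1]
      exact mul_le_mul_of_nonneg_left (A.le_opNorm v) hs.1
    have : s * (‖A‖ * ‖v‖) ≤ 1 * (‖A‖ * ‖v‖) := by gcongr; exact hs.2
    nlinarith
  by_contra! hneg
  have h0 : p.eval 0 = 1 := by simp [hp]
  have h1 : p.eval 1 ≤ 0 := by simpa [hp] using hneg
  obtain ⟨s, hs, hs0⟩ := intermediate_value_Icc' (zero_le_one' ℝ) p.continuous.continuousOn
    ⟨h1, h0 ▸ zero_le_one⟩
  exact hne s hs hs0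

theorem LipschitzWith.bijective_id_add {E : Type*} [NormedAddCommGroup E] [CompleteSpace E]
    {g : E → E} {K : NNReal} (hg : LipschitzWith K g) (hK : K < 1) :
    Function.Bijective fun x => x + g x := by
  have hc : ∀ y, ContractingWith K fun x => y - g x := fun y =>
    ⟨hK, LipschitzWith.of_dist_le_mul fun a c => by
      simpa [dist_eq_norm, norm_sub_rev] using hg.dist_le_mul c a⟩
  constructor
  · intro a c hac
    refine (hc (a + g a)).fixedPoint_unique' ?_ ?_
    · simp [Function.IsFixedPt]
    · have : a + g a = c + g c := hac
      simp [Function.IsFixedPt, this]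
  · intro y
    refine ⟨(hc y).fixedPoint, ?_⟩
    have := (hc y).fixedPoint_isFixedPt
    exact (sub_eq_iff_eq_add.mp this).symm

theorem LipschitzOnWith.indicator_closedBall {E F : Type*} [NormedAddCommGroup E]
    [NormedSpace ℝ E] [NormedAddCommGroup F] {g : E → F} {K : NNReal} {R : ℝ}
    (hg : LipschitzOnWith K g (closedBall 0 R)) (h0 : ∀ x ∈ sphere (0 : E) R, g x = 0) :
    LipschitzWith K ((closedBall 0 R).indicator g) := by
  have key : ∀ x ∈ closedBall (0 : E) R, ∀ y ∉ closedBall (0 : E) R,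
      dist (g x) 0 ≤ K * dist x y := by
    intro x hx y hy
    rw [mem_closedBall_zero_iff] at hx hy
    obtain ⟨z, hz, hzR⟩ := (convex_segment x y).isPreconnected.intermediate_value
      (left_mem_segment ℝ x y) (right_mem_segment ℝ x y) continuous_norm.continuousOn
      ⟨hx, (not_le.mp hy).le⟩
    have hzs : z ∈ sphere (0 : E) R := by simpa using hzR
    rw [← h0 z hzs]
    refine (hg.dist_le_mul x (by simpa using hx) z (sphere_subset_closedBall hzs)).trans ?_
    gcongr
    have := dist_add_dist_of_mem_segment hz
    linarith [dist_nonneg (x := z) (y := y)]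
  refine LipschitzWith.of_dist_le_mul fun x y => ?_
  by_cases hx : x ∈ closedBall (0 : E) R <;> by_cases hy : y ∈ closedBall (0 : E) R
  · simpa only [indicator_of_mem hx, indicator_of_mem hy] using hg.dist_le_mul x hx y hy
  · simpa only [indicator_of_mem hx, indicator_of_notMem hy] using key x hx y hy
  · rw [indicator_of_mem hy, indicator_of_notMem hx, dist_comm, dist_comm x]
    exact key y hy x hx
  · rw [indicator_of_notMem hx, indicator_of_notMem hy, dist_self]
    positivity

section NoRetraction

variable {E : Type*} [NormedAddCommGroup E] [InnerProductSpace ℝ E] [FiniteDimensional ℝ E]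

theorem det_fderiv_eq_zero_of_norm_eq {r : E → E} {R : ℝ} (hR : 0 < R) (hr : ∀ x, ‖r x‖ = R)
    {x : E} (hd : DifferentiableAt ℝ r x) : (fderiv ℝ r x).det = 0 := by
  have horth : ∀ v, inner ℝ (r x) (fderiv ℝ r x v) = 0 := by
    intro v
    have h1 := hd.hasFDerivAt.norm_sq
    have h2 : HasFDerivAt (fun y => ‖r y‖ ^ 2) (0 : E →L[ℝ] ℝ) x := by
      simp only [hr]
      exact hasFDerivAt_const _ _
    simpa using DFunLike.congr_fun (h1.unique h2) v
  by_contra hdet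
  obtain ⟨v, hv⟩ := (LinearMap.equivOfDetNeZero (fderiv ℝ r x : E →ₗ[ℝ] E) hdet).surjective (r x)
  have hv' : fderiv ℝ r x v = r x := hv
  have := horth v
  rw [hv', real_inner_self_eq_norm_sq, hr] at this
  exact absurd this (by positivity)

variable [MeasurableSpace E] [BorelSpace E]

theorem setIntegral_det_one_add_smul_fderiv {g : E → E} {K : NNReal} {R t : ℝ}
    (hg : ContDiff ℝ 1 g) (hK : ∀ x ∈ closedBall (0 : E) R, ‖fderiv ℝ g x‖₊ ≤ K)
    (h0 : ∀ x ∈ sphere (0 : E) R, g x = 0) (ht : 0 < t) (htK : t * K < 1) :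
    ∫ x in closedBall (0 : E) R, LinearMap.det (1 + t • (fderiv ℝ g x : E →ₗ[ℝ] E)) =
      volume.real (closedBall (0 : E) R) := by
  have hdiff : Differentiable ℝ g := hg.differentiable one_ne_zero
  have hlip : LipschitzWith K ((closedBall 0 R).indicator g) :=
    LipschitzOnWith.indicator_closedBall
      ((convex_closedBall 0 R).lipschitzOnWith_of_nnnorm_fderiv_le (fun x _ => hdiff x) hK) h0
  let F : E → E := fun x => x + t • (closedBall 0 R).indicator g x
  have hbij : Function.Bijective F := by
    refine LipschitzWith.bijective_id_add (g := fun x => t • (closedBall 0 R).indicator g x)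
      (K := ‖t‖₊ * K) ((lipschitzWith_smul t).comp hlip) ?_
    rw [← NNReal.coe_lt_coe]
    simpa [abs_of_pos ht] using htK
  have hout : F '' (closedBall 0 R)ᶜ = (closedBall 0 R)ᶜ := by
    have : EqOn F id (closedBall 0 R)ᶜ := fun x hx => by
      simp only [F, indicator_of_notMem hx, smul_zero, add_zero, id]
    rw [this.image_eq, image_id]
  have hin : F '' closedBall 0 R = closedBall 0 R := by
    rw [image_compl_eq hbij] at hout
    exact compl_injective hout
  have hder : ∀ x ∈ closedBall (0 : E) R,
      HasFDerivWithinAt F (1 + t • fderiv ℝ g x) (closedBall 0 R) x := by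
    intro x hx
    have h1 : HasFDerivAt (fun y => y + t • g y) (1 + t • fderiv ℝ g x) x :=
      (hasFDerivAt_id x).add ((hdiff x).hasFDerivAt.const_smul t)
    refine h1.hasFDerivWithinAt.congr (fun y hy => ?_) ?_
    · simp only [F, indicator_of_mem hy]
    · simp only [F, indicator_of_mem hx]
  have hcv := integral_image_eq_integral_abs_det_fderiv_smul volume
    isClosed_closedBall.measurableSet hder hbij.1.injOn (fun _ => (1 : ℝ))
  rw [hin] at hcv
  rw [← setIntegral_one_eq_measureReal, hcv]
  refine setIntegral_congr_fun isClosed_closedBall.measurableSet fun x hx => ?_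
  have hpos : 0 < LinearMap.det (1 + ((t • fderiv ℝ g x : E →L[ℝ] E) : E →ₗ[ℝ] E)) := by
    apply ContinuousLinearMap.det_one_add_pos
    rw [norm_smul, Real.norm_of_nonneg ht.le]
    refine lt_of_le_of_lt ?_ htK
    gcongr
    exact hK x hx
  simp only [smul_eq_mul, mul_one]
  exact (abs_of_pos hpos).symm

theorem not_exists_contDiff_retraction_sphere {r : E → E} {R : ℝ} (hR : 0 < R)
    (hr : ContDiff ℝ 1 r) (hnorm : ∀ x, ‖r x‖ = R) (hfix : ∀ x ∈ sphere (0 : E) R, r x = x) :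
    False := by
  let g : E → E := fun x => r x - x
  have hg : ContDiff ℝ 1 g := hr.sub contDiff_id
  have hfg : Continuous (fderiv ℝ g) := hg.continuous_fderiv one_ne_zero
  obtain ⟨K, hK⟩ : ∃ K : NNReal, ∀ x ∈ closedBall (0 : E) R, ‖fderiv ℝ g x‖₊ ≤ K := by
    obtain ⟨C, hC⟩ := (isCompact_closedBall (0 : E) R).exists_bound_of_continuousOn hfg.continuousOn
    exact ⟨C.toNNReal, fun x hx => NNReal.le_toNNReal_of_coe_le (hC x hx)⟩
  obtain ⟨w, t, ht, hw⟩ := exists_lagrange_quadrature (Module.finrank ℝ E)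
    (δ := 1 / (K + 1)) (by positivity)
  have hcont : ∀ s : ℝ, Continuous fun x =>
      LinearMap.det (1 + s • (fderiv ℝ g x : E →ₗ[ℝ] E)) := fun s =>
    ContinuousLinearMap.continuous_det.comp
      (f := fun x => (1 + s • fderiv ℝ g x : E →L[ℝ] E))
      (continuous_const.add (hfg.const_smul s))
  have hzero : ∀ x, LinearMap.det (1 + (1 : ℝ) • (fderiv ℝ g x : E →ₗ[ℝ] E)) = 0 := by
    intro x
    have hd : DifferentiableAt ℝ r x := hr.differentiable one_ne_zero x
    rw [← det_fderiv_eq_zero_of_norm_eq hR hnorm hd]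
    have : fderiv ℝ g x = fderiv ℝ r x - 1 :=
      (hd.hasFDerivAt.sub (hasFDerivAt_id x)).fderiv
    rw [this, ContinuousLinearMap.det]
    congr 1
    ext v
    simp
  have hpt : ∀ x, (0 : ℝ) = ∑ i ∈ Finset.range (Module.finrank ℝ E + 1),
      w i * LinearMap.det (1 + t i • (fderiv ℝ g x : E →ₗ[ℝ] E)) := by
    intro x
    obtain ⟨p, hp, hpe⟩ := LinearMap.exists_polynomial_eval_det_one_add_smul
      (fderiv ℝ g x : E →ₗ[ℝ] E)
    simp_rw [← hzero x, ← hpe]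
    exact hw p hp
  have hsum : ∑ i ∈ Finset.range (Module.finrank ℝ E + 1), w i = 1 := by
    simpa using (hw 1 (by simp)).symm
  have hint : ∫ _ in closedBall (0 : E) R, (0 : ℝ) = volume.real (closedBall (0 : E) R) := by
    calc ∫ _ in closedBall (0 : E) R, (0 : ℝ)
        = ∫ x in closedBall (0 : E) R, ∑ i ∈ Finset.range (Module.finrank ℝ E + 1),
            w i * LinearMap.det (1 + t i • (fderiv ℝ g x : E →ₗ[ℝ] E)) :=
          integral_congr_ae (.of_forall fun x => hpt x)
      _ = ∑ i ∈ Finset.range (Module.finrank ℝ E + 1),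
            w i * volume.real (closedBall (0 : E) R) := by
          rw [integral_finsetSum _ fun i _ =>
            ((hcont (t i)).continuousOn.integrableOn_compact
              (isCompact_closedBall 0 R)).const_mul (w i)]
          refine Finset.sum_congr rfl fun i _ => ?_
          rw [integral_const_mul, setIntegral_det_one_add_smul_fderiv hg hK
            (fun x hx => by simp [g, hfix x hx]) (ht i).1]
          have := (lt_div_iff₀ (by positivity)).mp (ht i).2
          nlinarith [(ht i).1]
      _ = volume.real (closedBall (0 : E) R) := by rw [← Finset.sum_mul, hsum, one_mul]
  have hvol : 0 < volume.real (closedBall (0 : E) R) :=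
    ENNReal.toReal_pos (measure_closedBall_pos _ _ hR).ne' measure_closedBall_lt_top.ne
  simp only [integral_zero] at hint
  exact hvol.ne hint

/-- **Brouwer's fixed point theorem** for bounded continuous self-maps of a Euclidean space. -/
theorem exists_fixedPoint_of_continuous_of_bounded {f : E → E} (hf : Continuous f) {M : ℝ}
    (hM : ∀ x, ‖f x‖ ≤ M) : ∃ x, f x = x := by
  by_contra! hne
  let χ : E → ℝ := fun x => max 0 (min 1 (M + 1 - ‖x‖))
  let h : E → E := fun x => χ x • f x
  have hχ : Continuous χ := by fun_prop
  have hh : Continuous h := hχ.smul hf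
  have hne' : ∀ x, 0 < ‖x - h x‖ := by
    intro x
    rw [norm_pos_iff, sub_ne_zero]
    intro hx
    have hle : ‖x‖ ≤ M := by
      have h0 : 0 ≤ χ x := le_max_left _ _
      have h1 : χ x ≤ 1 := max_le zero_le_one (min_le_left _ _)
      rw [hx, norm_smul, Real.norm_of_nonneg h0]
      exact (mul_le_of_le_one_left (norm_nonneg _) h1).trans (hM x)
    have : χ x = 1 := by
      simp only [χ]
      rw [min_eq_left (by linarith), max_eq_right zero_le_one]
    exact hne x (by simpa [h, this] using hx.symm)
  obtain ⟨p, hp, hpd, hps⟩ := hh.exists_contDiff_approx 1 (ε := fun x => ‖x - h x‖)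
    (by fun_prop) hne'
  have hp0 : ∀ x, x - p x ≠ 0 := by
    intro x hx
    have := hpd x
    rw [← sub_eq_zero.mp hx, dist_eq_norm] at this
    exact lt_irrefl _ this
  have hM0 : 0 ≤ M := (norm_nonneg _).trans (hM 0)
  have hR : 0 < M + 1 := by linarith
  refine not_exists_contDiff_retraction_sphere (E := E) (R := M + 1)
    (r := fun x => ((M + 1) / ‖x - p x‖) • (x - p x)) hR ?_ ?_ ?_
  · have hsub : ContDiff ℝ 1 fun x => x - p x := contDiff_id.sub hp
    exact (contDiff_const.div (hsub.norm ℝ hp0) fun x => norm_ne_zero_iff.mpr (hp0 x)).smul hsub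
  · intro x
    rw [norm_smul, norm_div, norm_norm, Real.norm_of_nonneg hR.le,
      div_mul_cancel₀ _ (norm_ne_zero_iff.mpr (hp0 x))]
  · intro x hx
    rw [mem_sphere_zero_iff_norm] at hx
    have hpx : p x = 0 := by
      by_contra hpx
      refine hps hpx ?_
      simp [h, χ, hx]
    simp [hpx, hx, hR.ne']

end NoRetraction

/-- **Brouwer's fixed point theorem** for the standard simplex. -/
theorem exists_fixedPoint_stdSimplex {ι : Type*} [Fintype ι] [Nonempty ι]
    {f : (ι → ℝ) → ι → ℝ} (hf : ContinuousOn f (stdSimplex ℝ ι))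
    (hmaps : MapsTo f (stdSimplex ℝ ι) (stdSimplex ℝ ι)) :
    ∃ x ∈ stdSimplex ℝ ι, f x = x := by
  have hcard : (0 : ℝ) < Fintype.card ι := by exact_mod_cast Fintype.card_pos
  let s : (ι → ℝ) → ℝ := fun x => ∑ i, max 0 (x i)
  let ρ : (ι → ℝ) → ι → ℝ := fun x i =>
    (max 0 (x i) + max 0 (1 - s x) / Fintype.card ι) / max 1 (s x)
  have hpos : ∀ x, 0 < max 1 (s x) := fun x => lt_max_of_lt_left one_pos
  have hs : Continuous s := by fun_prop
  have hρ : Continuous ρ := continuous_pi fun i =>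
    Continuous.div (by fun_prop) (by fun_prop) fun x => (hpos x).ne'
  have hρ_mem : ∀ x, ρ x ∈ stdSimplex ℝ ι := by
    intro x
    refine ⟨fun i => div_nonneg (by positivity) (hpos x).le, ?_⟩
    simp only [ρ]
    rw [← Finset.sum_div, div_eq_one_iff_eq (hpos x).ne', Finset.sum_add_distrib, Finset.sum_const,
      Finset.card_univ, nsmul_eq_mul, mul_div_cancel₀ _ hcard.ne']
    change s x + _ = _
    rcases le_total 1 (s x) with h | h
    · rw [max_eq_left (by linarith), max_eq_right h, add_zero]
    · rw [max_eq_right (by linarith), max_eq_left h, add_sub_cancel]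
  have hρ_fix : ∀ x ∈ stdSimplex ℝ ι, ρ x = x := by
    intro x hx
    have hsx : s x = 1 := by
      simp only [s, max_eq_right (hx.1 _)]
      exact hx.2
    ext i
    simp [ρ, hsx, max_eq_right (hx.1 i)]
  have hfρ : Continuous fun x => f (ρ x) := hf.comp_continuous hρ hρ_mem
  obtain ⟨M, hM⟩ := (isCompact_stdSimplex ℝ ι).exists_bound_of_continuousOn
    (f := fun x : ι → ℝ => WithLp.toLp 2 x) (PiLp.continuous_toLp 2 _).continuousOn
  obtain ⟨x, hx⟩ := exists_fixedPoint_of_continuous_of_bounded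
    (E := EuclideanSpace ℝ ι) (f := fun x => WithLp.toLp 2 (f (ρ x.ofLp)))
    ((PiLp.continuous_toLp 2 _).comp (hfρ.comp (PiLp.continuous_ofLp 2 _)))
    fun x => hM _ (hmaps (hρ_mem _))
  have hx' : f (ρ x.ofLp) = x.ofLp := congrArg WithLp.ofLp hx
  have hmem : x.ofLp ∈ stdSimplex ℝ ι := hx' ▸ hmaps (hρ_mem _)
  exact ⟨x.ofLp, hmem, by rwa [hρ_fix _ hmem] at hx'⟩

section Cone

variable {E : Type*} [NormedAddCommGroup E] [NormedSpace ℝ E]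

theorem PointedCone.sum_smul_ne_zero {ι : Type*} [Fintype ι] {P : PointedCone ℝ E}
    (hP : ∀ u ∈ P, -u ∈ P → u = 0) {y : ι → E} (hy : ∀ i, y i ∈ P) (hy0 : ∀ i, y i ≠ 0)
    {x : ι → ℝ} (hx : x ∈ stdSimplex ℝ ι) : ∑ i, x i • y i ≠ 0 := by
  classical
  intro h
  have hmem : ∀ i, x i • y i ∈ P := fun i => P.smul_mem (hx.1 i) (hy i)
  have hzero : ∀ j, x j = 0 := by
    intro j
    rw [← Finset.add_sum_erase _ _ (Finset.mem_univ j)] at h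
    have := hP _ (hmem j) (by
      rw [neg_eq_of_add_eq_zero_right h]
      exact P.sum_mem fun i _ => hmem i)
    exact (smul_eq_zero.mp this).resolve_right (hy0 j)
  have := hx.2
  simp [hzero] at this

/-- The Schauder projection onto the convex hull of a finite net. -/
theorem exists_continuousOn_stdSimplex_norm_sub_le {ι : Type*} [Fintype ι] {G : Set E}
    {y : ι → E} {ε : ℝ} (hG : ∀ z ∈ G, ∃ i, dist z (y i) < ε) :
    ∃ c : E → ι → ℝ, ContinuousOn c G ∧ MapsTo c G (stdSimplex ℝ ι) ∧
      ∀ z ∈ G, ‖∑ i, c z i • y i - z‖ ≤ ε := by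
  let ω : ι → E → ℝ := fun i z => max 0 (ε - dist z (y i))
  have hω : ∀ i z, 0 ≤ ω i z := fun i z => le_max_left _ _
  have hsum : ∀ z ∈ G, 0 < ∑ i, ω i z := by
    intro z hz
    obtain ⟨i, hi⟩ := hG z hz
    exact Finset.sum_pos' (fun i _ => hω i z)
      ⟨i, Finset.mem_univ i, lt_max_of_lt_right (sub_pos.mpr hi)⟩
  have hmaps : ∀ z ∈ G, (fun i => ω i z / ∑ j, ω j z) ∈ stdSimplex ℝ ι := fun z hz =>
    ⟨fun i => div_nonneg (hω i z) (hsum z hz).le, by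
      rw [← Finset.sum_div, div_self (hsum z hz).ne']⟩
  refine ⟨fun z i => ω i z / ∑ j, ω j z, ?_, hmaps, fun z hz => ?_⟩
  · refine continuousOn_pi.mpr fun i => ContinuousOn.div ?_ ?_ fun z hz => (hsum z hz).ne'
    · fun_prop
    · fun_prop
  · set c : ι → ℝ := fun i => ω i z / ∑ j, ω j z with hc
    obtain ⟨hc0, hc1⟩ : c ∈ stdSimplex ℝ ι := hmaps z hz
    calc ‖∑ i, c i • y i - z‖ = ‖∑ i, c i • (y i - z)‖ := by
          simp_rw [smul_sub, Finset.sum_sub_distrib, ← Finset.sum_smul]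
          rw [hc1, one_smul]
      _ ≤ ∑ i, ‖c i • (y i - z)‖ := norm_sum_le _ _
      _ ≤ ∑ i, c i * ε := by
          refine Finset.sum_le_sum fun i _ => ?_
          rw [norm_smul, Real.norm_of_nonneg (hc0 i)]
          rcases le_or_gt ε (dist z (y i)) with h | h
          · have : c i = 0 := by
              simp only [hc, ω]
              rw [max_eq_left (by linarith), zero_div]
            rw [this, zero_mul, zero_mul]
          · rw [dist_comm, dist_eq_norm] at h
            exact mul_le_mul_of_nonneg_left h.le (hc0 i)
      _ = ε := by rw [← Finset.sum_mul, hc1, one_mul]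

theorem PointedCone.inv_norm_smul_mem {P : PointedCone ℝ E} {u : E} (hu : u ∈ P) (hu0 : u ≠ 0) :
    ‖u‖⁻¹ • u ∈ (P : Set E) ∩ sphere 0 1 :=
  ⟨P.smul_mem (by positivity) hu, by simp [norm_smul, hu0]⟩

theorem PointedCone.exists_approx_eigenvector {P : PointedCone ℝ E}
    (hP : ∀ u ∈ P, -u ∈ P → u = 0) (hne : ∃ u ∈ P, u ≠ 0) {F : E → E} {G : Set E}
    (hF : ContinuousOn F ((P : Set E) ∩ sphere 0 1)) (hG : IsCompact G) (hGP : G ⊆ P)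
    (hG0 : (0 : E) ∉ G) (hmaps : MapsTo F ((P : Set E) ∩ sphere 0 1) G) {ε : ℝ} (hε : 0 < ε) :
    ∃ u ∈ P, u ≠ 0 ∧ ‖u - F (‖u‖⁻¹ • u)‖ ≤ ε := by
  obtain ⟨t, htG, htfin, hcover⟩ := hG.finite_cover_balls hε
  have := htfin.fintype
  have hnet : ∀ z ∈ G, ∃ i : t, dist z (i : E) < ε := by
    intro z hz
    obtain ⟨i, hi, hzi⟩ := mem_iUnion₂.mp (hcover hz)
    exact ⟨⟨i, hi⟩, hzi⟩
  obtain ⟨p, hp, hp0⟩ := hne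
  obtain ⟨i₀, -⟩ := hnet _ (hmaps (P.inv_norm_smul_mem hp hp0))
  have : Nonempty t := ⟨i₀⟩
  obtain ⟨c, hc, hcmaps, hcnorm⟩ := exists_continuousOn_stdSimplex_norm_sub_le hnet
  let u : (t → ℝ) → E := fun x => ∑ i, x i • (i : E)
  have hu : Continuous u := by fun_prop
  have hu_mem : ∀ x ∈ stdSimplex ℝ t, u x ∈ P := fun x hx =>
    P.sum_mem fun i _ => P.smul_mem (hx.1 i) (hGP (htG i.2))
  have hu0 : ∀ x ∈ stdSimplex ℝ t, u x ≠ 0 := fun x hx =>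
    P.sum_smul_ne_zero hP (fun i => hGP (htG i.2)) (fun i h => hG0 (h ▸ htG i.2)) hx
  have hv : MapsTo (fun x => ‖u x‖⁻¹ • u x) (stdSimplex ℝ t) ((P : Set E) ∩ sphere 0 1) :=
    fun x hx => P.inv_norm_smul_mem (hu_mem x hx) (hu0 x hx)
  have hvc : ContinuousOn (fun x => ‖u x‖⁻¹ • u x) (stdSimplex ℝ t) :=
    (hu.norm.continuousOn.inv₀ fun x hx => norm_ne_zero_iff.mpr (hu0 x hx)).smul hu.continuousOn
  obtain ⟨x, hx, hfx⟩ := exists_fixedPoint_stdSimplex (f := fun x => c (F (‖u x‖⁻¹ • u x)))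
    (hc.comp (hF.comp hvc hv) (hmaps.comp hv)) (hcmaps.comp (hmaps.comp hv))
  refine ⟨u x, hu_mem x hx, hu0 x hx, ?_⟩
  have := hcnorm _ (hmaps (hv hx))
  rwa [show c (F (‖u x‖⁻¹ • u x)) = x from hfx] at this

theorem PointedCone.exists_eigenvector {P : PointedCone ℝ E}
    (hP : ∀ u ∈ P, -u ∈ P → u = 0) (hne : ∃ u ∈ P, u ≠ 0) {F : E → E} {G : Set E}
    (hF : ContinuousOn F ((P : Set E) ∩ sphere 0 1)) (hG : IsCompact G) (hGP : G ⊆ P)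
    (hG0 : (0 : E) ∉ G) (hmaps : MapsTo F ((P : Set E) ∩ sphere 0 1) G) :
    ∃ v ∈ P, ‖v‖ = 1 ∧ ∃ l : ℝ, 0 < l ∧ F v = l • v := by
  choose u huP hu0 hu using fun n : ℕ =>
    exists_approx_eigenvector hP hne hF hG hGP hG0 hmaps (Nat.one_div_pos_of_nat (α := ℝ) (n := n))
  have hv : ∀ n, ‖u n‖⁻¹ • u n ∈ (P : Set E) ∩ sphere 0 1 := fun n =>
    P.inv_norm_smul_mem (huP n) (hu0 n)
  obtain ⟨y, hyG, φ, hφ, hy⟩ := hG.tendsto_subseq fun n => hmaps (hv n)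
  have hy0 : y ≠ 0 := fun h => hG0 (h ▸ hyG)
  have hdiff : Filter.Tendsto (fun n => u n - F (‖u n‖⁻¹ • u n)) Filter.atTop (nhds 0) :=
    squeeze_zero_norm hu tendsto_one_div_add_atTop_nhds_zero_nat
  have hlim : Filter.Tendsto (fun n => u (φ n)) Filter.atTop (nhds y) := by
    simpa using (hdiff.comp hφ.tendsto_atTop).add hy
  have hvlim : Filter.Tendsto (fun n => ‖u (φ n)‖⁻¹ • u (φ n)) Filter.atTop
      (nhds (‖y‖⁻¹ • y)) := (hlim.norm.inv₀ (norm_ne_zero_iff.mpr hy0)).smul hlim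
  have hvy := P.inv_norm_smul_mem (hGP hyG) hy0
  have hFlim := ((hF _ hvy).tendsto.comp (tendsto_nhdsWithin_iff.mpr
    ⟨hvlim, .of_forall fun n => hv (φ n)⟩))
  refine ⟨_, hvy.1, by simpa using hvy.2, ‖y‖, norm_pos_iff.mpr hy0, ?_⟩
  rw [smul_inv_smul₀ (norm_ne_zero_iff.mpr hy0)]
  exact tendsto_nhds_unique hFlim hy

end Cone

section Bilinear

variable {E : Type*} [NormedAddCommGroup E] [NormedSpace ℝ E] [CompleteSpace E]

/-- A positive operator with cone norm less than `1` has a resolvent `(1 - L)⁻¹` on the cone,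
continuous on bounded sets. -/
theorem PointedCone.exists_resolvent {P : PointedCone ℝ E} (hclosed : IsClosed (P : Set E))
    {L : E →L[ℝ] E} (hLP : ∀ v ∈ P, L v ∈ P) {q : ℝ} (hq0 : 0 ≤ q) (hq : q < 1)
    (hL : ∀ v ∈ P, ‖L v‖ ≤ q * ‖v‖) :
    ∃ R : E → E, (∀ M : ℝ, ContinuousOn R ((P : Set E) ∩ closedBall 0 M)) ∧
      (∀ v ∈ P, R v ∈ P) ∧ ∀ v ∈ P, R v - L (R v) = v := by
  have hpow : ∀ n : ℕ, ∀ v ∈ P, (L ^ n) v ∈ P ∧ ‖(L ^ n) v‖ ≤ q ^ n * ‖v‖ := by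
    intro n v hv
    induction n with
    | zero => simpa using hv
    | succ n ih =>
      rw [pow_succ', mul_apply_eq_comp]
      refine ⟨hLP _ ih.1, (hL _ ih.1).trans ?_⟩
      rw [pow_succ', mul_assoc]
      exact mul_le_mul_of_nonneg_left ih.2 hq0
  have hgeom : ∀ M : ℝ, Summable fun n : ℕ => q ^ n * M := fun M =>
    (summable_geometric_of_lt_one hq0 hq).mul_right M
  have hsum : ∀ v ∈ P, Summable fun n : ℕ => (L ^ n) v := fun v hv =>
    (hgeom ‖v‖).of_norm_bounded fun n => (hpow n v hv).2
  refine ⟨fun v => ∑' n : ℕ, (L ^ n) v, fun M => ?_, fun v hv => ?_, fun v hv => ?_⟩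
  · refine continuousOn_tsum (fun n => (L ^ n).continuous.continuousOn) (hgeom M) fun n v hv => ?_
    refine (hpow n v hv.1).2.trans ?_
    gcongr
    simpa using hv.2
  · exact hclosed.mem_of_tendsto (hsum v hv).hasSum
      (.of_forall fun s => P.sum_mem fun n _ => (hpow n v hv).1)
  · simp only [L.map_tsum (hsum v hv)]
    rw [(hsum v hv).tsum_eq_zero_add]
    simp [pow_succ']

theorem PointedCone.exists_small_fixedPoint {P : PointedCone ℝ E}
    (hclosed : IsClosed (P : Set E)) {b : E →L[ℝ] E →L[ℝ] E}
    (hbP : ∀ u ∈ P, ∀ v ∈ P, b u v ∈ P) {B : ℝ} (hB0 : 0 ≤ B)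
    (hB : ∀ u ∈ P, ∀ v ∈ P, ‖b u v‖ ≤ B * ‖u‖ * ‖v‖) {u₀ : E} (hu₀ : u₀ ∈ P)
    (hsmall : 4 * B * ‖u₀‖ < 1) :
    ∃ u ∈ P, ‖u‖ ≤ 2 * ‖u₀‖ ∧ u = b u u + u₀ := by
  let T : E → E := fun u => b u u + u₀
  have hT : Continuous T := by fun_prop
  let x : ℕ → E := fun n => T^[n] 0
  have hx : ∀ n, x (n + 1) = b (x n) (x n) + u₀ := fun n => Function.iterate_succ_apply' T n 0
  have hxP : ∀ n, x n ∈ P := by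
    intro n
    induction n with
    | zero => exact P.zero_mem
    | succ n ih =>
      rw [hx]
      exact P.add_mem (hbP _ ih _ ih) hu₀
  have hxn : ∀ n, ‖x n‖ ≤ 2 * ‖u₀‖ := by
    intro n
    induction n with
    | zero => simp [x]
    | succ n ih =>
      rw [hx]
      have h1 : B * ‖x n‖ * ‖x n‖ ≤ B * (2 * ‖u₀‖) * (2 * ‖u₀‖) := by gcongr
      have h2 := norm_add_le (b (x n) (x n)) u₀
      have h3 := hB _ (hxP n) _ (hxP n)
      nlinarith [norm_nonneg u₀]
  have hd : ∀ n, x (n + 1) - x n ∈ P ∧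
      ‖x (n + 1) - x n‖ ≤ ‖u₀‖ * (4 * B * ‖u₀‖) ^ n := by
    intro n
    induction n with
    | zero => simpa [x, T] using hu₀
    | succ n ih =>
      have heq : x (n + 1 + 1) - x (n + 1) =
          b (x (n + 1)) (x (n + 1) - x n) + b (x (n + 1) - x n) (x n) := by
        calc x (n + 1 + 1) - x (n + 1)
            = b (x (n + 1)) (x (n + 1)) + u₀ - (b (x n) (x n) + u₀) := by rw [hx (n + 1), ← hx n]
          _ = _ := by
            simp only [map_sub, sub_apply]
            abel
      rw [heq]
      refine ⟨P.add_mem (hbP _ (hxP _) _ ih.1) (hbP _ ih.1 _ (hxP _)), ?_⟩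
      calc _ ≤ ‖b (x (n + 1)) (x (n + 1) - x n)‖ + ‖b (x (n + 1) - x n) (x n)‖ :=
            norm_add_le _ _
        _ ≤ B * ‖x (n + 1)‖ * ‖x (n + 1) - x n‖ + B * ‖x (n + 1) - x n‖ * ‖x n‖ :=
            add_le_add (hB _ (hxP _) _ ih.1) (hB _ ih.1 _ (hxP _))
        _ ≤ B * (2 * ‖u₀‖) * ‖x (n + 1) - x n‖ + B * ‖x (n + 1) - x n‖ * (2 * ‖u₀‖) := by
            gcongr <;> exact hxn _
        _ = 4 * B * ‖u₀‖ * ‖x (n + 1) - x n‖ := by ring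
        _ ≤ 4 * B * ‖u₀‖ * (‖u₀‖ * (4 * B * ‖u₀‖) ^ n) := by gcongr; exact ih.2
        _ = _ := by ring
  have hcauchy : CauchySeq x := cauchySeq_of_le_geometric (4 * B * ‖u₀‖) ‖u₀‖ hsmall fun n => by
    rw [dist_comm, dist_eq_norm]
    exact (hd n).2
  obtain ⟨u, hu⟩ := cauchySeq_tendsto_of_complete hcauchy
  refine ⟨u, hclosed.mem_of_tendsto hu (.of_forall hxP),
    le_of_tendsto hu.norm (.of_forall hxn), ?_⟩
  exact (isFixedPt_of_tendsto_iterate hu hT.continuousAt).symm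

theorem PointedCone.exists_pos_fixedPoint {P : PointedCone ℝ E}
    (hclosed : IsClosed (P : Set E)) (hP : ∀ u ∈ P, -u ∈ P → u = 0) (hne : ∃ u ∈ P, u ≠ 0)
    {b : E →L[ℝ] E →L[ℝ] E} {L : E →L[ℝ] E} {Q : Set E} (hQ : IsCompact Q) (hQP : Q ⊆ P)
    (hbQ : ∀ u ∈ (P : Set E) ∩ sphere 0 1, b u u ∈ Q) {C : ℝ} (hC : 0 < C)
    (hbC : ∀ u ∈ (P : Set E) ∩ sphere 0 1, C ≤ ‖b u u‖) (hLP : ∀ v ∈ P, L v ∈ P) {q : ℝ}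
    (hq0 : 0 ≤ q) (hq : q < 1) (hL : ∀ v ∈ P, ‖L v‖ ≤ q * ‖v‖) :
    ∃ w ∈ P, w ≠ 0 ∧ w = L w + b w w := by
  obtain ⟨R, hRc, hRP, hR⟩ := exists_resolvent hclosed hLP hq0 hq hL
  obtain ⟨M, hM⟩ := hQ.isBounded.subset_closedBall 0
  have hRQ : ContinuousOn R Q := (hRc M).mono (subset_inter hQP hM)
  let Z : Set E := {z | C ≤ ‖z - L z‖}
  have hZ : IsClosed Z := isClosed_le continuous_const (by fun_prop)
  obtain ⟨v, hv, hv1, l, hl, hlv⟩ := exists_eigenvector (F := fun u => R (b u u))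
    (G := R '' Q ∩ Z) hP hne
    (hRQ.comp (Continuous.continuousOn (by fun_prop)) hbQ)
    ((hQ.image_of_continuousOn hRQ).inter_right hZ)
    (by rintro _ ⟨⟨z, hz, rfl⟩, -⟩; exact hRP z (hQP hz))
    (fun h => by simpa [Z, hC.not_ge] using h.2)
    (fun u hu => ⟨mem_image_of_mem R (hbQ u hu), by
      simpa only [Z, mem_ofPred_eq, hR _ (hQP (hbQ u hu))] using hbC u hu⟩)
  have hvS : v ∈ (P : Set E) ∩ sphere 0 1 := ⟨hv, by simpa using hv1⟩
  have hb : l • v - L (l • v) = b v v := by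
    have := hR _ (hQP (hbQ v hvS))
    rwa [show R (b v v) = l • v from hlv] at this
  refine ⟨l⁻¹ • v, P.smul_mem (by positivity) hv,
    smul_ne_zero (by positivity) (norm_ne_zero_iff.mp (by simp [hv1])), ?_⟩
  simp only [map_smul, smul_apply, ← hb, ← smul_sub]
  rw [inv_smul_smul₀ hl.ne', smul_sub]
  abel

end Bilinear
end ConeFixedPoint

/-- Main theorem of the paper: if `b` is a bounded bilinear form mapping the closed cone
`P × P` into `P`, compact on `P`, with cone norm `B` and coercive on `P`, then for every
nonzero `u₀ ∈ P` with `4·B·‖u₀‖ < 1` the equation `u = b(u,u) + u₀` has at least two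
distinct solutions in `P`. -/
theorem two_fixed_points_of_bilinear_form
    {E : Type*} [NormedAddCommGroup E] [NormedSpace ℝ E] [CompleteSpace E]
    (P : Set E)
    -- `P` is a closed cone:
    (hPclosed : IsClosed P) (hPconvex : Convex ℝ P)
    (hPscale : ∀ lam : ℝ, 0 ≤ lam → ∀ u ∈ P, lam • u ∈ P)
    (hPpointed : ∀ u ∈ P, -u ∈ P → u = 0)
    -- `b` is a bounded bilinear map:
    (b : E → E → E)
    (hb_add_left : ∀ u v w : E, b (u + v) w = b u w + b v w)
    (hb_smul_left : ∀ (c : ℝ) (u w : E), b (c • u) w = c • b u w)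
    (hb_add_right : ∀ u v w : E, b u (v + w) = b u v + b u w)
    (hb_smul_right : ∀ (c : ℝ) (u w : E), b u (c • w) = c • b u w)
    (hb_bounded : ∃ M : ℝ, ∀ u v : E, ‖b u v‖ ≤ M * ‖u‖ * ‖v‖)
    -- `b` maps `P × P` into `P`:
    (hb_maps : ∀ u ∈ P, ∀ v ∈ P, b u v ∈ P)
    -- `b` is compact on `P`: it maps bounded subsets of `P × P` to relatively compact sets:
    (hb_compact : ∀ S ⊆ P ×ˢ P, IsBounded S →
      IsCompact (closure ((fun p : E × E => b p.1 p.2) '' S)))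
    -- `B` is the norm of `b` on the cone:
    (B : ℝ)
    (hB : IsLUB {x : ℝ | ∃ u ∈ P, ∃ v ∈ P, ‖u‖ = 1 ∧ ‖v‖ = 1 ∧ x = ‖b u v‖} B)
    -- coercivity condition (5):
    (hcoercive : ∃ C : ℝ, 0 < C ∧ IsGLB {x : ℝ | ∃ u ∈ P, ‖u‖ = 1 ∧ x = ‖b u u‖} C) :
    ∀ u₀ ∈ P, u₀ ≠ 0 → 4 * B * ‖u₀‖ < 1 →
      ∃ u ∈ P, ∃ v ∈ P, u ≠ v ∧ u = b u u + u₀ ∧ v = b v v + u₀ := by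
  intro u₀ hu₀ hu₀0 hsmall
  have hadd : ∀ u ∈ P, ∀ v ∈ P, u + v ∈ P := by
    intro u hu v hv
    have h := hPscale 2 zero_le_two _
      (hPconvex hu hv (by norm_num : (0 : ℝ) ≤ 1 / 2) (by norm_num : (0 : ℝ) ≤ 1 / 2) (by norm_num))
    simpa [smul_smul] using h
  let K : PointedCone ℝ E :=
    { carrier := P
      add_mem' := fun hu hv => hadd _ hu _ hv
      zero_mem' := by simpa using hPscale 0 le_rfl u₀ hu₀
      smul_mem' := fun c _ hu => hPscale c c.2 _ hu }
  obtain ⟨M, hM⟩ := hb_bounded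
  let β : E →L[ℝ] E →L[ℝ] E :=
    (LinearMap.mk₂ ℝ b hb_add_left hb_smul_left hb_add_right hb_smul_right).mkContinuous₂ M hM
  have hβ : ∀ u v, β u v = b u v := fun _ _ => rfl
  have hB' : ∀ u ∈ P, ∀ v ∈ P, ‖b u v‖ ≤ B * ‖u‖ * ‖v‖ := by
    intro u hu v hv
    rcases eq_or_ne u 0 with rfl | hu0
    · simp [← hβ]
    rcases eq_or_ne v 0 with rfl | hv0
    · simp [← hβ]
    have h := hB.1 ⟨‖u‖⁻¹ • u, hPscale _ (by positivity) _ hu, ‖v‖⁻¹ • v,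
      hPscale _ (by positivity) _ hv, by simp [norm_smul, hu0], by simp [norm_smul, hv0], rfl⟩
    rw [hb_smul_left, hb_smul_right, norm_smul, norm_smul, norm_inv, norm_inv, norm_norm,
      norm_norm] at h
    have hun : 0 < ‖u‖ := norm_pos_iff.mpr hu0
    have hvn : 0 < ‖v‖ := norm_pos_iff.mpr hv0
    rw [inv_mul_le_iff₀ hun, inv_mul_le_iff₀ hvn] at h
    linarith
  have hun : 0 < ‖u₀‖ := norm_pos_iff.mpr hu₀0
  have hB0 : 0 ≤ B := by
    have h := (norm_nonneg _).trans (hB' u₀ hu₀ u₀ hu₀)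
    rw [mul_assoc] at h
    exact nonneg_of_mul_nonneg_left h (by positivity)
  obtain ⟨u, hu, hun, hufix⟩ := K.exists_small_fixedPoint hPclosed (b := β) hb_maps hB0 hB' hu₀
    hsmall
  obtain ⟨C, hC, hCglb⟩ := hcoercive
  let S : Set (E × E) := (P ∩ Metric.sphere 0 1) ×ˢ (P ∩ Metric.sphere 0 1)
  have hSP : S ⊆ P ×ˢ P := prod_mono inter_subset_left inter_subset_left
  have hSb : IsBounded S :=
    (Metric.isBounded_sphere.subset inter_subset_right).prod
      (Metric.isBounded_sphere.subset inter_subset_right)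
  obtain ⟨w, hw, hw0, hwfix⟩ := K.exists_pos_fixedPoint hPclosed hPpointed ⟨u₀, hu₀, hu₀0⟩
    (b := β) (L := β u + β.flip u) (hb_compact S hSP hSb)
    (closure_minimal (by rintro _ ⟨p, hp, rfl⟩; exact hb_maps _ (hSP hp).1 _ (hSP hp).2) hPclosed)
    (fun v hv => subset_closure ⟨(v, v), ⟨hv, hv⟩, rfl⟩) hC
    (fun v hv => hCglb.1 ⟨v, hv.1, by simpa using hv.2, rfl⟩)
    (fun v hv => hadd _ (hb_maps _ hu _ hv) _ (hb_maps _ hv _ hu))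
    (q := 4 * B * ‖u₀‖) (by positivity) hsmall
    (fun v hv => by
      calc ‖b u v + b v u‖ ≤ ‖b u v‖ + ‖b v u‖ := norm_add_le _ _
        _ ≤ B * ‖u‖ * ‖v‖ + B * ‖v‖ * ‖u‖ := add_le_add (hB' _ hu _ hv) (hB' _ hv _ hu)
        _ ≤ B * (2 * ‖u₀‖) * ‖v‖ + B * ‖v‖ * (2 * ‖u₀‖) := by gcongr
        _ = 4 * B * ‖u₀‖ * ‖v‖ := by ring)
  refine ⟨u, hu, u + w, hadd u hu w hw, by simpa using hw0, hufix, ?_⟩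
  have hw' : w = b u w + b w u + b w w := hwfix
  have hu' : u = b u u + u₀ := hufix
  rw [hb_add_left, hb_add_right, hb_add_right]
  nth_rewrite 1 [hu', hw']
  abel
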